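/- arXiv:1408.2302 — 10 statements merged into one kernel-verified Lean document; each statement's English description precedes it below -/
import Mathlib

section
/- Let σ² > 0, B_max > 0, and let ξ ≥ 0, r ∈ [0, B_max], β ≥ 0, ρ ≥ 0 be real numbers satisfying the stationarity condition σ² 2^{−2r} = ξ − β/(2 ln 2) + ρ/(2 ln 2) and the complementary slackness conditions (β > 0 implies r = 0) and (ρ > 0 implies r = B_max). Then the distortion D = σ² 2^{−2r} satisfies D = σ² 2^{−2B_max} if ξ ≤ σ² 2^{−2B_max}; D = ξ if σ² 2^{−2B_max} < ξ < σ²; and D = σ² if ξ ≥ σ²; i.e., D = min(σ², max(σ² 2^{−2B_max}, ξ)). -/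
/-- A point `d` of `[a, b]` is the projection of `x` onto `[a, b]` as soon as it lies above `x`
unless `d = b`, and below `x` unless `d = a`. -/
theorem eq_min_max_of_forall_lt {α : Type*} [LinearOrder α] {a b d x : α} (had : a ≤ d)
    (hdb : d ≤ b) (hb : d < b → x ≤ d) (ha : a < d → d ≤ x) : d = min b (max a x) := by
  apply le_antisymm
  · refine le_min hdb ?_
    rcases had.eq_or_lt with h | h
    · exact h ▸ le_max_left _ _
    · exact (ha h).trans (le_max_right _ _)
  · rcases hdb.eq_or_lt with h | h
    · exact h ▸ min_le_left _ _
    · exact (min_le_right _ _).trans (max_le had (hb h))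

/-- KKT characterization of the optimal distortion: under the stationarity condition
`σ² 2^{−2r} = ξ − β/(2 ln 2) + ρ/(2 ln 2)` and complementary slackness, the distortion
`D = σ² 2^{−2r}` equals `σ² 2^{−2B_max}` when `ξ ≤ σ² 2^{−2B_max}`, equals `ξ` when
`σ² 2^{−2B_max} < ξ < σ²`, equals `σ²` when `ξ ≥ σ²`; i.e.
`D = min(σ², max(σ² 2^{−2B_max}, ξ))`. -/
theorem stmt_5 (σsq Bmax ξ r β ρ : ℝ) (hσ : 0 < σsq) (hB : 0 < Bmax)
    (hξ : 0 ≤ ξ) (hr0 : 0 ≤ r) (hrB : r ≤ Bmax) (hβ : 0 ≤ β) (hρ : 0 ≤ ρ)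
    (hstat : σsq * (2 : ℝ) ^ (-2 * r)
      = ξ - β / (2 * Real.log 2) + ρ / (2 * Real.log 2))
    (hcsβ : 0 < β → r = 0) (hcsρ : 0 < ρ → r = Bmax) :
    (ξ ≤ σsq * (2 : ℝ) ^ (-2 * Bmax) →
      σsq * (2 : ℝ) ^ (-2 * r) = σsq * (2 : ℝ) ^ (-2 * Bmax)) ∧
    (σsq * (2 : ℝ) ^ (-2 * Bmax) < ξ ∧ ξ < σsq →
      σsq * (2 : ℝ) ^ (-2 * r) = ξ) ∧
    (σsq ≤ ξ → σsq * (2 : ℝ) ^ (-2 * r) = σsq) ∧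
    σsq * (2 : ℝ) ^ (-2 * r) = min σsq (max (σsq * (2 : ℝ) ^ (-2 * Bmax)) ξ) := by
  have hlog : 0 < 2 * Real.log 2 := mul_pos two_pos (Real.log_pos one_lt_two)
  have hβ' : 0 ≤ β / (2 * Real.log 2) := div_nonneg hβ hlog.le
  have hρ' : 0 ≤ ρ / (2 * Real.log 2) := div_nonneg hρ hlog.le
  have hlow : σsq * (2 : ℝ) ^ (-2 * Bmax) ≤ σsq * (2 : ℝ) ^ (-2 * r) :=
    mul_le_mul_of_nonneg_left
      (Real.rpow_le_rpow_of_exponent_le one_le_two (by linarith)) hσ.le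
  have hup : σsq * (2 : ℝ) ^ (-2 * r) ≤ σsq :=
    mul_le_of_le_one_right hσ.le
      (Real.rpow_le_one_of_one_le_of_nonpos one_le_two (by linarith))
  have hβ_zero : σsq * (2 : ℝ) ^ (-2 * r) < σsq → ξ ≤ σsq * (2 : ℝ) ^ (-2 * r) := by
    intro h
    rcases hβ.eq_or_lt with rfl | hpos
    · rw [zero_div] at hstat
      linarith
    · simp [hcsβ hpos] at h
  have hρ_zero : σsq * (2 : ℝ) ^ (-2 * Bmax) < σsq * (2 : ℝ) ^ (-2 * r) →
      σsq * (2 : ℝ) ^ (-2 * r) ≤ ξ := by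
    intro h
    rcases hρ.eq_or_lt with rfl | hpos
    · rw [zero_div] at hstat
      linarith
    · rw [hcsρ hpos] at h
      exact absurd h (lt_irrefl _)
  have hD := eq_min_max_of_forall_lt hlow hup hβ_zero hρ_zero
  have hm := hlow.trans hup
  refine ⟨fun h => ?_, fun h => ?_, fun h => ?_, hD⟩
  · rw [hD, max_eq_left h, min_eq_right hm]
  · rw [hD, max_eq_right h.1.le, min_eq_right h.2.le]
  · rw [hD, min_eq_left (h.trans (le_max_right _ _))]
end

section
/- Under the complementary-slackness setup with reverse water levels ξ_i, for every i with 1 ≤ i ≤ N−1: if ξ_{i+1} > ξ_i, then at least one of the following equalities holds: (a) Σ_{j=i+1}^N r_j = Σ_{j=i+1}^N c_j; (b) there exists j with i+1 ≤ j ≤ N−d such that Σ_{m=i+1}^j r_m = Σ_{m=i+1}^{j+d−1} c_m; (c) there exists j with i+1 ≤ j ≤ N−1 such that Σ_{m=i+1}^{j+1} r_m = Σ_{m=i+1}^j c_m + B_max. (Each alternative means that all samples collected until time slot i are transmitted by the end of time slot i.) -/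
theorem Finset.sum_Icc_add_one_top {M : Type*} [AddCommMonoid M] (f : ℤ → M) {i : ℤ} (hi : 1 ≤ i) :
    ∑ k ∈ Finset.Icc 1 (i + 1), f k = ∑ k ∈ Finset.Icc 1 i, f k + f (i + 1) := by
  have h : Finset.Icc 1 (i + 1) = insert (i + 1) (Finset.Icc 1 i) := by
    ext k
    simp only [Finset.mem_Icc, Finset.mem_insert]
    omega
  rw [h, Finset.sum_insert (by simp), add_comm]

theorem Finset.sum_Icc_sum_Icc_le_of_le (f : ℤ → ℤ → ℝ) (hf : ∀ j k, 0 ≤ f j k) {a b : ℤ}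
    (hab : a ≤ b) (i m : ℤ) :
    ∑ k ∈ Finset.Icc 1 i, ∑ j ∈ Finset.Icc b m, f j k
      ≤ ∑ k ∈ Finset.Icc 1 i, ∑ j ∈ Finset.Icc a m, f j k :=
  Finset.sum_le_sum fun k _ => Finset.sum_le_sum_of_subset_of_nonneg
    (Finset.Icc_subset_Icc_left hab) fun j _ _ => hf j k


/-- Lemma 1 (increase of the reverse water level): under the complementary-slackness
setup, if `ξ_{i+1} > ξ_i` then all samples collected until time slot `i` are transmitted
by the end of time slot `i`, i.e. one of the equalities (a), (b), (c) holds. -/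
theorem stmt_7 (N d : ℤ) (hN : 1 ≤ N) (hd1 : 1 ≤ d) (hdN : d ≤ N)
    (Bmax : ℝ) (hB : 0 < Bmax)
    (r c γ : ℤ → ℝ) (δ ζ : ℤ → ℤ → ℝ) (ξ : ℤ → ℝ)
    (hγ : ∀ i, 0 ≤ γ i)
    (hδ : ∀ i k, 0 ≤ δ i k)
    (hζ : ∀ i k, 0 ≤ ζ i k)
    (hγ0 : ∀ i, ¬(1 ≤ i ∧ i ≤ N) → γ i = 0)
    (hδ0 : ∀ i k, ¬(1 ≤ k ∧ k ≤ i ∧ i ≤ N - d) → δ i k = 0)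
    (hζ0 : ∀ i k, ¬(1 ≤ k ∧ k ≤ i ∧ i ≤ N - 1) → ζ i k = 0)
    (hγcs : ∀ i, 0 < γ i →
      ∑ j ∈ Finset.Icc i N, r j = ∑ j ∈ Finset.Icc i N, c j)
    (hδcs : ∀ i k, 0 < δ i k →
      ∑ j ∈ Finset.Icc k i, r j = ∑ j ∈ Finset.Icc k (i + d - 1), c j)
    (hζcs : ∀ i k, 0 < ζ i k →
      ∑ j ∈ Finset.Icc k (i + 1), r j = ∑ j ∈ Finset.Icc k i, c j + Bmax)
    (hξ : ∀ i, ξ i = (1 / (2 * Real.log 2)) *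
      (∑ j ∈ Finset.Icc 1 i, γ j
        + ∑ k ∈ Finset.Icc 1 i, ∑ j ∈ Finset.Icc i (N - d), δ j k
        + ∑ k ∈ Finset.Icc 1 i, ∑ j ∈ Finset.Icc (i - 1) (N - 1), ζ j k)) :
    ∀ i, 1 ≤ i → i ≤ N - 1 → ξ i < ξ (i + 1) →
      (∑ j ∈ Finset.Icc (i + 1) N, r j = ∑ j ∈ Finset.Icc (i + 1) N, c j) ∨
      (∃ j, i + 1 ≤ j ∧ j ≤ N - d ∧
        ∑ m ∈ Finset.Icc (i + 1) j, r m
          = ∑ m ∈ Finset.Icc (i + 1) (j + d - 1), c m) ∨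
      (∃ j, i + 1 ≤ j ∧ j ≤ N - 1 ∧
        ∑ m ∈ Finset.Icc (i + 1) (j + 1), r m
          = ∑ m ∈ Finset.Icc (i + 1) j, c m + Bmax) := by
  intro i hi1 _ hlt
  by_contra! hcon
  obtain ⟨ha, hb, hc⟩ := hcon
  have hγi : γ (i + 1) = 0 :=
    ((hγ _).eq_or_lt.resolve_right fun h => ha (hγcs _ h)).symm
  have hδi : ∑ j ∈ Finset.Icc (i + 1) (N - d), δ j (i + 1) = 0 := by
    refine Finset.sum_eq_zero fun j hj => ?_
    rw [Finset.mem_Icc] at hj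
    exact ((hδ _ _).eq_or_lt.resolve_right fun h => hb j hj.1 hj.2 (hδcs _ _ h)).symm
  have hζi : ∑ j ∈ Finset.Icc (i + 1 - 1) (N - 1), ζ j (i + 1) = 0 := by
    refine Finset.sum_eq_zero fun j hj => ?_
    rw [Finset.mem_Icc] at hj
    by_cases hij : i + 1 ≤ j
    · exact ((hζ _ _).eq_or_lt.resolve_right fun h => hc j hij hj.2 (hζcs _ _ h)).symm
    · exact hζ0 _ _ fun h => hij h.2.1
  have hδle := Finset.sum_Icc_sum_Icc_le_of_le δ hδ (a := i) (b := i + 1) (by omega) i (N - d)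
  have hζle :=
    Finset.sum_Icc_sum_Icc_le_of_le ζ hζ (a := i - 1) (b := i + 1 - 1) (by omega) i (N - 1)
  have hlog : 0 ≤ 1 / (2 * Real.log 2) := by positivity
  refine hlt.not_ge ?_
  rw [hξ i, hξ (i + 1)]
  refine mul_le_mul_of_nonneg_left ?_ hlog
  rw [Finset.sum_Icc_add_one_top _ hi1, Finset.sum_Icc_add_one_top _ hi1,
    Finset.sum_Icc_add_one_top _ hi1, hγi, hδi, hζi]
  linarith
end

section
/- Under the complementary-slackness setup with reverse water levels ξ_i, for every i with 1 ≤ i ≤ N−1: if ξ_{i+1} < ξ_i, then at least one of the following equalities holds: (a) there exists k with 1 ≤ k ≤ i ≤ N−d such that Σ_{j=k}^i r_j = Σ_{j=k}^{i+d−1} c_j (delivery of later-arriving samples is postponed); or (b) there exists k with 1 ≤ k ≤ i−1 such that Σ_{j=k}^i r_j = Σ_{j=k}^{i−1} c_j + B_max (the data buffer is full at the beginning of time slot i). -/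
/-- Dropping a vanishing first row and adding a nonnegative column does not decrease a
double sum of nonnegative terms. -/
theorem sum_Icc_sum_Icc_le_of_row_eq_zero (F : ℤ → ℤ → ℝ) (hF : ∀ j k, 0 ≤ F j k)
    (m i a b : ℤ) (h0 : ∀ k ∈ Finset.Icc m i, F a k = 0) :
    ∑ k ∈ Finset.Icc m i, ∑ j ∈ Finset.Icc a b, F j k
      ≤ ∑ k ∈ Finset.Icc m (i + 1), ∑ j ∈ Finset.Icc (a + 1) b, F j k := by
  calc ∑ k ∈ Finset.Icc m i, ∑ j ∈ Finset.Icc a b, F j k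
      = ∑ k ∈ Finset.Icc m i, ∑ j ∈ Finset.Icc (a + 1) b, F j k := by
        refine Finset.sum_congr rfl fun k hk => ?_
        symm
        refine Finset.sum_subset (Finset.Icc_subset_Icc (by omega) le_rfl) fun j hj hj' => ?_
        have hja : j = a := by
          simp only [Finset.mem_Icc] at hj hj'
          omega
        rw [hja, h0 k hk]
    _ ≤ _ := Finset.sum_le_sum_of_subset_of_nonneg
        (Finset.Icc_subset_Icc le_rfl (by omega))
        fun k _ _ => Finset.sum_nonneg fun j _ => hF j k


/-- Lemma 1 (decrease of the reverse water level): under the complementary-slackness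
setup, if `ξ_{i+1} < ξ_i` then either delivery of later-arriving samples is postponed
(case (a)) or the data buffer is full at the beginning of time slot `i` (case (b)). -/
theorem stmt_8 (N d : ℤ) (hN : 1 ≤ N) (hd1 : 1 ≤ d) (hdN : d ≤ N)
    (Bmax : ℝ) (hB : 0 < Bmax)
    (r c γ : ℤ → ℝ) (δ ζ : ℤ → ℤ → ℝ) (ξ : ℤ → ℝ)
    (hγ : ∀ i, 0 ≤ γ i)
    (hδ : ∀ i k, 0 ≤ δ i k)
    (hζ : ∀ i k, 0 ≤ ζ i k)
    (hγ0 : ∀ i, ¬(1 ≤ i ∧ i ≤ N) → γ i = 0)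
    (hδ0 : ∀ i k, ¬(1 ≤ k ∧ k ≤ i ∧ i ≤ N - d) → δ i k = 0)
    (hζ0 : ∀ i k, ¬(1 ≤ k ∧ k ≤ i ∧ i ≤ N - 1) → ζ i k = 0)
    (hγcs : ∀ i, 0 < γ i →
      ∑ j ∈ Finset.Icc i N, r j = ∑ j ∈ Finset.Icc i N, c j)
    (hδcs : ∀ i k, 0 < δ i k →
      ∑ j ∈ Finset.Icc k i, r j = ∑ j ∈ Finset.Icc k (i + d - 1), c j)
    (hζcs : ∀ i k, 0 < ζ i k →
      ∑ j ∈ Finset.Icc k (i + 1), r j = ∑ j ∈ Finset.Icc k i, c j + Bmax)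
    (hξ : ∀ i, ξ i = (1 / (2 * Real.log 2)) *
      (∑ j ∈ Finset.Icc 1 i, γ j
        + ∑ k ∈ Finset.Icc 1 i, ∑ j ∈ Finset.Icc i (N - d), δ j k
        + ∑ k ∈ Finset.Icc 1 i, ∑ j ∈ Finset.Icc (i - 1) (N - 1), ζ j k)) :
    ∀ i, 1 ≤ i → i ≤ N - 1 → ξ (i + 1) < ξ i →
      (∃ k, 1 ≤ k ∧ k ≤ i ∧ i ≤ N - d ∧
        ∑ j ∈ Finset.Icc k i, r j = ∑ j ∈ Finset.Icc k (i + d - 1), c j) ∨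
      (∃ k, 1 ≤ k ∧ k ≤ i - 1 ∧
        ∑ j ∈ Finset.Icc k i, r j = ∑ j ∈ Finset.Icc k (i - 1), c j + Bmax) := by
  intro i _ _ hlt
  by_contra! hcon
  obtain ⟨hA, hB'⟩ := hcon
  have hδi : ∀ k ∈ Finset.Icc 1 i, δ i k = 0 := by
    intro k hk
    rw [Finset.mem_Icc] at hk
    by_cases hi : i ≤ N - d
    · by_contra hne
      exact hA k hk.1 hk.2 hi (hδcs i k (lt_of_le_of_ne (hδ i k) (Ne.symm hne)))
    · exact hδ0 i k (by omega)
  have hζi : ∀ k ∈ Finset.Icc 1 i, ζ (i - 1) k = 0 := by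
    intro k hk
    rw [Finset.mem_Icc] at hk
    by_cases hki : k ≤ i - 1
    · by_contra hne
      have heq := hζcs (i - 1) k (lt_of_le_of_ne (hζ (i - 1) k) (Ne.symm hne))
      rw [sub_add_cancel] at heq
      exact hB' k hk.1 hki heq
    · exact hζ0 (i - 1) k (by omega)
  have hγle : ∑ j ∈ Finset.Icc 1 i, γ j ≤ ∑ j ∈ Finset.Icc 1 (i + 1), γ j :=
    Finset.sum_le_sum_of_subset_of_nonneg (Finset.Icc_subset_Icc le_rfl (by omega))
      fun j _ _ => hγ j
  have hδle := sum_Icc_sum_Icc_le_of_row_eq_zero δ hδ 1 i i (N - d) hδi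
  have hζle := sum_Icc_sum_Icc_le_of_row_eq_zero ζ hζ 1 i (i - 1) (N - 1) hζi
  have hlog : 0 ≤ 1 / (2 * Real.log 2) := by positivity
  refine absurd hlt (not_lt.mpr ?_)
  rw [hξ i, hξ (i + 1), show i + 1 - 1 = i - 1 + 1 by ring]
  exact mul_le_mul_of_nonneg_left (add_le_add (add_le_add hγle hδle) hζle) hlog
end

section
/- Under the complementary-slackness setup with water levels ν_i, for every i with 1 ≤ i ≤ N−1: if ν_{i+1} > ν_i, then at least one of the following equalities holds: (a) Σ_{j=i+1}^N r_j = Σ_{j=i+1}^N c_j; (b) there exists j with i+1 ≤ j ≤ N−d such that Σ_{m=i+1}^j r_m = Σ_{m=i+1}^{j+d−1} c_m; (c) there exists j with i+1 ≤ j ≤ N−1 such that Σ_{m=i+1}^{j+1} r_m = Σ_{m=i+1}^j c_m + B_max. (Each alternative means that all samples collected until time slot i are transmitted by the end of time slot i.) -/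
theorem sum_Icc_one_add_one {i : ℤ} (hi : 1 ≤ i) (f : ℤ → ℝ) :
    ∑ j ∈ Finset.Icc 1 (i + 1), f j = ∑ j ∈ Finset.Icc 1 i, f j + f (i + 1) := by
  have h : Finset.Icc 1 (i + 1) = insert (i + 1) (Finset.Icc 1 i) := by
    ext x
    simp only [Finset.mem_insert, Finset.mem_Icc]
    lia
  rw [h, Finset.sum_insert (by simp), add_comm]

/-- Raising the lower end of the inner range cannot increase a double sum of nonnegative terms
when the newly added row vanishes. -/
theorem sum_Icc_sum_Icc_add_one_le {i a b : ℤ} (hi : 1 ≤ i) {f : ℤ → ℤ → ℝ}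
    (hf : ∀ j k, 0 ≤ f j k) (hrow : ∀ j ≤ b, f j (i + 1) = 0) :
    ∑ k ∈ Finset.Icc 1 (i + 1), ∑ j ∈ Finset.Icc (a + 1) b, f j k
      ≤ ∑ k ∈ Finset.Icc 1 i, ∑ j ∈ Finset.Icc a b, f j k := by
  rw [sum_Icc_one_add_one hi,
    Finset.sum_eq_zero (s := Finset.Icc (a + 1) b) fun j hj => hrow j (Finset.mem_Icc.1 hj).2,
    add_zero]
  exact Finset.sum_le_sum fun k _ => Finset.sum_le_sum_of_subset_of_nonneg
    (Finset.Icc_subset_Icc_left (by lia)) fun j _ _ => hf j k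

/-- Lemma 2 (increase of the water level): under the complementary-slackness setup with
water levels `ν_i`, if `ν_{i+1} > ν_i` then all samples collected until time slot `i`
are transmitted by the end of time slot `i`, i.e. one of (a), (b), (c) holds. -/
theorem stmt_9 (N d : ℤ) (hN : 1 ≤ N) (hd1 : 1 ≤ d) (hdN : d ≤ N)
    (Bmax : ℝ) (hB : 0 < Bmax) (lam : ℝ) (hlam : 0 < lam)
    (r c γ : ℤ → ℝ) (δ ζ : ℤ → ℤ → ℝ) (ν : ℤ → ℝ)
    (hγ : ∀ i, 0 ≤ γ i)
    (hδ : ∀ i k, 0 ≤ δ i k)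
    (hζ : ∀ i k, 0 ≤ ζ i k)
    (hγ0 : ∀ i, ¬(1 ≤ i ∧ i ≤ N) → γ i = 0)
    (hδ0 : ∀ i k, ¬(1 ≤ k ∧ k ≤ i ∧ i ≤ N - d) → δ i k = 0)
    (hζ0 : ∀ i k, ¬(1 ≤ k ∧ k ≤ i ∧ i ≤ N - 1) → ζ i k = 0)
    (hγcs : ∀ i, 0 < γ i →
      ∑ j ∈ Finset.Icc i N, r j = ∑ j ∈ Finset.Icc i N, c j)
    (hδcs : ∀ i k, 0 < δ i k →
      ∑ j ∈ Finset.Icc k i, r j = ∑ j ∈ Finset.Icc k (i + d - 1), c j)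
    (hζcs : ∀ i k, 0 < ζ i k →
      ∑ j ∈ Finset.Icc k (i + 1), r j = ∑ j ∈ Finset.Icc k i, c j + Bmax)
    (hν : ∀ i, ν i =
      (∑ j ∈ Finset.Icc 1 i, γ j
        + ∑ k ∈ Finset.Icc 1 i, ∑ j ∈ Finset.Icc (i - d + 1) (N - d), δ j k
        + ∑ k ∈ Finset.Icc 1 i, ∑ j ∈ Finset.Icc i (N - 1), ζ j k)
      / (2 * Real.log 2 * lam)) :
    ∀ i, 1 ≤ i → i ≤ N - 1 → ν i < ν (i + 1) →
      (∑ j ∈ Finset.Icc (i + 1) N, r j = ∑ j ∈ Finset.Icc (i + 1) N, c j) ∨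
      (∃ j, i + 1 ≤ j ∧ j ≤ N - d ∧
        ∑ m ∈ Finset.Icc (i + 1) j, r m
          = ∑ m ∈ Finset.Icc (i + 1) (j + d - 1), c m) ∨
      (∃ j, i + 1 ≤ j ∧ j ≤ N - 1 ∧
        ∑ m ∈ Finset.Icc (i + 1) (j + 1), r m
          = ∑ m ∈ Finset.Icc (i + 1) j, c m + Bmax) := by
  intro i hi1 hiN hlt
  by_contra! hcon
  obtain ⟨ha, hb, hc⟩ := hcon
  have eγ : γ (i + 1) = 0 :=
    le_antisymm (not_lt.1 fun h => ha (hγcs _ h)) (hγ _)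
  have eδ : ∀ j ≤ N - d, δ j (i + 1) = 0 := by
    intro j hj
    by_cases hij : i + 1 ≤ j
    · exact le_antisymm (not_lt.1 fun h => hb j hij hj (hδcs _ _ h)) (hδ _ _)
    · exact hδ0 _ _ (by lia)
  have eζ : ∀ j ≤ N - 1, ζ j (i + 1) = 0 := by
    intro j hj
    by_cases hij : i + 1 ≤ j
    · exact le_antisymm (not_lt.1 fun h => hc j hij hj (hζcs _ _ h)) (hζ _ _)
    · exact hζ0 _ _ (by lia)
  have hγle := sum_Icc_one_add_one hi1 γ
  rw [eγ, add_zero] at hγle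
  have hδle := sum_Icc_sum_Icc_add_one_le (a := i - d + 1) hi1 hδ eδ
  have hζle := sum_Icc_sum_Icc_add_one_le (a := i) hi1 hζ eζ
  have hlog : 0 < Real.log 2 := Real.log_pos one_lt_two
  refine hlt.not_ge ?_
  rw [hν i, hν (i + 1), hγle, show i + 1 - d + 1 = i - d + 1 + 1 by ring]
  gcongr
end

section
/- Under the complementary-slackness setup with water levels ν_i, for every i with 1 ≤ i ≤ N−1: if ν_{i+1} < ν_i, then at least one of the following equalities holds: (a) there exists k with 1 ≤ k ≤ i−d+1 ≤ N−d such that Σ_{j=k}^{i−d+1} r_j = Σ_{j=k}^{i} c_j (delivery of samples collected in slots after k is postponed); or (b) there exists k with 1 ≤ k ≤ i ≤ N−1 such that Σ_{j=k}^{i+1} r_j = Σ_{j=k}^i c_j + B_max (the data buffer is full at the beginning of time slot i+1). -/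
/-- Moving the lower limit of the inner sum up by one loses nothing if the dropped row vanishes,
and enlarging the outer range only adds nonnegative terms. -/
theorem sum_Icc_sum_Icc_le_succ {f : ℤ → ℤ → ℝ} (hf : ∀ j k, 0 ≤ f j k) {a : ℤ}
    (ha : ∀ k, f a k = 0) (i M : ℤ) :
    ∑ k ∈ Finset.Icc 1 i, ∑ j ∈ Finset.Icc a M, f j k
      ≤ ∑ k ∈ Finset.Icc 1 (i + 1), ∑ j ∈ Finset.Icc (a + 1) M, f j k := by
  have inner (k : ℤ) :
      ∑ j ∈ Finset.Icc a M, f j k = ∑ j ∈ Finset.Icc (a + 1) M, f j k := by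
    refine (Finset.sum_subset (Finset.Icc_subset_Icc_left (by lia)) fun j hj hj' => ?_).symm
    simp only [Finset.mem_Icc] at hj hj'
    obtain rfl : j = a := by lia
    exact ha k
  simp only [inner]
  exact Finset.sum_le_sum_of_subset_of_nonneg (Finset.Icc_subset_Icc_right (by lia))
    fun k _ _ => Finset.sum_nonneg fun j _ => hf j k


/-- Lemma 2 (decrease of the water level): under the complementary-slackness setup with
water levels `ν_i`, if `ν_{i+1} < ν_i` then either delivery of samples is postponed
(case (a)) or the data buffer is full at the beginning of time slot `i+1` (case (b)). -/
theorem stmt_10 (N d : ℤ) (hN : 1 ≤ N) (hd1 : 1 ≤ d) (hdN : d ≤ N)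
    (Bmax : ℝ) (hB : 0 < Bmax) (lam : ℝ) (hlam : 0 < lam)
    (r c γ : ℤ → ℝ) (δ ζ : ℤ → ℤ → ℝ) (ν : ℤ → ℝ)
    (hγ : ∀ i, 0 ≤ γ i)
    (hδ : ∀ i k, 0 ≤ δ i k)
    (hζ : ∀ i k, 0 ≤ ζ i k)
    (hγ0 : ∀ i, ¬(1 ≤ i ∧ i ≤ N) → γ i = 0)
    (hδ0 : ∀ i k, ¬(1 ≤ k ∧ k ≤ i ∧ i ≤ N - d) → δ i k = 0)
    (hζ0 : ∀ i k, ¬(1 ≤ k ∧ k ≤ i ∧ i ≤ N - 1) → ζ i k = 0)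
    (hγcs : ∀ i, 0 < γ i →
      ∑ j ∈ Finset.Icc i N, r j = ∑ j ∈ Finset.Icc i N, c j)
    (hδcs : ∀ i k, 0 < δ i k →
      ∑ j ∈ Finset.Icc k i, r j = ∑ j ∈ Finset.Icc k (i + d - 1), c j)
    (hζcs : ∀ i k, 0 < ζ i k →
      ∑ j ∈ Finset.Icc k (i + 1), r j = ∑ j ∈ Finset.Icc k i, c j + Bmax)
    (hν : ∀ i, ν i =
      (∑ j ∈ Finset.Icc 1 i, γ j
        + ∑ k ∈ Finset.Icc 1 i, ∑ j ∈ Finset.Icc (i - d + 1) (N - d), δ j k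
        + ∑ k ∈ Finset.Icc 1 i, ∑ j ∈ Finset.Icc i (N - 1), ζ j k)
      / (2 * Real.log 2 * lam)) :
    ∀ i, 1 ≤ i → i ≤ N - 1 → ν (i + 1) < ν i →
      (∃ k, 1 ≤ k ∧ k ≤ i - d + 1 ∧ i - d + 1 ≤ N - d ∧
        ∑ j ∈ Finset.Icc k (i - d + 1), r j = ∑ j ∈ Finset.Icc k i, c j) ∨
      (∃ k, 1 ≤ k ∧ k ≤ i ∧ i ≤ N - 1 ∧
        ∑ j ∈ Finset.Icc k (i + 1), r j = ∑ j ∈ Finset.Icc k i, c j + Bmax) := by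
  intro i hi hiN hlt
  by_contra! ⟨hpost, hfull⟩
  refine hlt.not_ge ?_
  have hδz (k : ℤ) : δ (i - d + 1) k = 0 := by
    by_contra hne
    obtain ⟨hk, hki, hid⟩ := not_imp_comm.mp (hδ0 (i - d + 1) k) hne
    refine hpost k hk hki hid ?_
    have hcs := hδcs _ _ ((hδ _ _).lt_of_ne' hne)
    rwa [show i - d + 1 + d - 1 = i by ring] at hcs
  have hζz (k : ℤ) : ζ i k = 0 := by
    by_contra hne
    obtain ⟨hk, hki, hiN'⟩ := not_imp_comm.mp (hζ0 i k) hne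
    exact hfull k hk hki hiN' (hζcs _ _ ((hζ _ _).lt_of_ne' hne))
  have hγ_le : ∑ j ∈ Finset.Icc 1 i, γ j ≤ ∑ j ∈ Finset.Icc 1 (i + 1), γ j :=
    Finset.sum_le_sum_of_subset_of_nonneg (Finset.Icc_subset_Icc_right (by lia))
      fun j _ _ => hγ j
  have hδ_le := sum_Icc_sum_Icc_le_succ hδ hδz i (N - d)
  have hζ_le := sum_Icc_sum_Icc_le_succ hζ hζz i (N - 1)
  have hlog : 0 < Real.log 2 := Real.log_pos one_lt_two
  rw [hν i, hν (i + 1), show i + 1 - d + 1 = i - d + 1 + 1 by ring]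
  gcongr
end

section
/- Under the complementary-slackness setup of the energy-harvesting problem with water levels π_i, for every i with 1 ≤ i ≤ N−1: if π_{i+1} > π_i, then at least one of the following equalities holds: (a) Σ_{j=i+1}^N r_j = Σ_{j=i+1}^N c_j; (b) there exists j with i+1 ≤ j ≤ N−d such that Σ_{m=i+1}^j r_m = Σ_{m=i+1}^{j+d−1} c_m; (c) there exists j with i+1 ≤ j ≤ N−1 such that Σ_{m=i+1}^{j+1} r_m = Σ_{m=i+1}^j c_m + B_max; or (d) Σ_{j=1}^i (2^{2c_j} − 1)/h_j = Σ_{j=1}^i E_j (the battery is empty at the end of time slot i). -/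
theorem Int.sum_Icc_one_succ {M : Type*} [AddCommMonoid M] (f : ℤ → M) {n : ℤ} (hn : 0 ≤ n) :
    ∑ j ∈ Finset.Icc 1 (n + 1), f j = ∑ j ∈ Finset.Icc 1 n, f j + f (n + 1) := by
  have h : Finset.Icc 1 (n + 1) = insert (n + 1) (Finset.Icc 1 n) := by
    ext j
    simp only [Finset.mem_Icc, Finset.mem_insert]
    omega
  rw [h, Finset.sum_insert (by simp), add_comm]

theorem Int.sum_Icc_eq_add_sum_Icc_succ {M : Type*} [AddCommMonoid M] (f : ℤ → M) {m n : ℤ}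
    (hmn : m ≤ n) :
    ∑ j ∈ Finset.Icc m n, f j = f m + ∑ j ∈ Finset.Icc (m + 1) n, f j := by
  have h : Finset.Icc m n = insert m (Finset.Icc (m + 1) n) := by
    ext j
    simp only [Finset.mem_Icc, Finset.mem_insert]
    omega
  rw [h, Finset.sum_insert (by simp)]

/-- Lemma 3 (increase of the water level, energy-harvesting case): under the
complementary-slackness setup with water levels `π_i`, if `π_{i+1} > π_i` then either
all samples collected until time slot `i` are transmitted by the end of slot `i`
(cases (a), (b), (c)) or the battery is empty at the end of time slot `i` (case (d)). -/
theorem stmt_11 (N d : ℤ) (hN : 1 ≤ N) (hd1 : 1 ≤ d) (hdN : d ≤ N)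
    (Bmax : ℝ) (hB : 0 < Bmax)
    (ch E : ℤ → ℝ) (hch : ∀ i, 1 ≤ i → i ≤ N → 0 < ch i)
    (hE : ∀ i, 1 ≤ i → i ≤ N → 0 ≤ E i)
    (r c γ lam : ℤ → ℝ) (δ ζ : ℤ → ℤ → ℝ) (π : ℤ → ℝ)
    (hlam : ∀ i, 0 ≤ lam i)
    (hlam0 : ∀ i, ¬(1 ≤ i ∧ i ≤ N) → lam i = 0)
    (hΛ : ∀ i, 1 ≤ i → i ≤ N → 0 < ∑ j ∈ Finset.Icc i N, lam j)
    (hγ : ∀ i, 0 ≤ γ i)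
    (hδ : ∀ i k, 0 ≤ δ i k)
    (hζ : ∀ i k, 0 ≤ ζ i k)
    (hγ0 : ∀ i, ¬(1 ≤ i ∧ i ≤ N) → γ i = 0)
    (hδ0 : ∀ i k, ¬(1 ≤ k ∧ k ≤ i ∧ i ≤ N - d) → δ i k = 0)
    (hζ0 : ∀ i k, ¬(1 ≤ k ∧ k ≤ i ∧ i ≤ N - 1) → ζ i k = 0)
    (hlamcs : ∀ i, 0 < lam i →
      ∑ j ∈ Finset.Icc 1 i, ((2 : ℝ) ^ (2 * c j) - 1) / ch j
        = ∑ j ∈ Finset.Icc 1 i, E j)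
    (hγcs : ∀ i, 0 < γ i →
      ∑ j ∈ Finset.Icc i N, r j = ∑ j ∈ Finset.Icc i N, c j)
    (hδcs : ∀ i k, 0 < δ i k →
      ∑ j ∈ Finset.Icc k i, r j = ∑ j ∈ Finset.Icc k (i + d - 1), c j)
    (hζcs : ∀ i k, 0 < ζ i k →
      ∑ j ∈ Finset.Icc k (i + 1), r j = ∑ j ∈ Finset.Icc k i, c j + Bmax)
    (hπ : ∀ i, π i =
      (∑ j ∈ Finset.Icc 1 i, γ j
        + ∑ k ∈ Finset.Icc 1 i, ∑ j ∈ Finset.Icc (i - d + 1) (N - d), δ j k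
        + ∑ k ∈ Finset.Icc 1 i, ∑ j ∈ Finset.Icc i (N - 1), ζ j k)
      / (2 * Real.log 2 * ∑ j ∈ Finset.Icc i N, lam j)) :
    ∀ i, 1 ≤ i → i ≤ N - 1 → π i < π (i + 1) →
      (∑ j ∈ Finset.Icc (i + 1) N, r j = ∑ j ∈ Finset.Icc (i + 1) N, c j) ∨
      (∃ j, i + 1 ≤ j ∧ j ≤ N - d ∧
        ∑ m ∈ Finset.Icc (i + 1) j, r m
          = ∑ m ∈ Finset.Icc (i + 1) (j + d - 1), c m) ∨
      (∃ j, i + 1 ≤ j ∧ j ≤ N - 1 ∧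
        ∑ m ∈ Finset.Icc (i + 1) (j + 1), r m
          = ∑ m ∈ Finset.Icc (i + 1) j, c m + Bmax) ∨
      (∑ j ∈ Finset.Icc 1 i, ((2 : ℝ) ^ (2 * c j) - 1) / ch j
        = ∑ j ∈ Finset.Icc 1 i, E j) := by
  intro i hi1 hiN hlt
  by_contra hcon
  push Not at hcon
  obtain ⟨ha, hb, hc, hd⟩ := hcon
  have eq_zero_of_not_pos : ∀ x : ℝ, 0 ≤ x → ¬ 0 < x → x = 0 := fun x h h' =>
    le_antisymm (not_lt.mp h') h
  have hlam_i : lam i = 0 := eq_zero_of_not_pos _ (hlam i) fun h => hd (hlamcs i h)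
  have hγ_i : γ (i + 1) = 0 := eq_zero_of_not_pos _ (hγ _) fun h => ha (hγcs _ h)
  have hδ_i : ∀ j, δ j (i + 1) = 0 := fun j => by
    by_cases hj : 1 ≤ i + 1 ∧ i + 1 ≤ j ∧ j ≤ N - d
    · exact eq_zero_of_not_pos _ (hδ _ _) fun h => hb j hj.2.1 hj.2.2 (hδcs _ _ h)
    · exact hδ0 _ _ hj
  have hζ_i : ∀ j, ζ j (i + 1) = 0 := fun j => by
    by_cases hj : 1 ≤ i + 1 ∧ i + 1 ≤ j ∧ j ≤ N - 1
    · exact eq_zero_of_not_pos _ (hζ _ _) fun h => hc j hj.2.1 hj.2.2 (hζcs _ _ h)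
    · exact hζ0 _ _ hj
  have hsum : ∑ j ∈ Finset.Icc i N, lam j = ∑ j ∈ Finset.Icc (i + 1) N, lam j := by
    rw [Int.sum_Icc_eq_add_sum_Icc_succ lam (by omega), hlam_i, zero_add]
  have hpos : 0 < 2 * Real.log 2 * ∑ j ∈ Finset.Icc (i + 1) N, lam j :=
    mul_pos (mul_pos two_pos (Real.log_pos one_lt_two)) (hΛ _ (by omega) (by omega))
  refine absurd hlt (not_lt.mpr ?_)
  rw [hπ i, hπ (i + 1), hsum]
  simp only [Int.sum_Icc_one_succ _ (show 0 ≤ i by omega), hγ_i, hδ_i, hζ_i,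
    Finset.sum_const_zero, add_zero]
  refine div_le_div_of_nonneg_right (add_le_add (add_le_add le_rfl ?_) ?_) hpos.le
  · exact Finset.sum_le_sum fun k _ => Finset.sum_le_sum_of_subset_of_nonneg
      (Finset.Icc_subset_Icc_left (by omega)) fun j _ _ => hδ j k
  · exact Finset.sum_le_sum fun k _ => Finset.sum_le_sum_of_subset_of_nonneg
      (Finset.Icc_subset_Icc_left (by omega)) fun j _ _ => hζ j k
end

section
/- Let N ≥ 1, let σ_i > 0 and h_i > 0 for i = 1,…,N, let B_max > 0, E ≥ 0, and λ > 0. Define c*_i = max(0, min(B_max, (1/2) log₂(σ_i √h_i / λ))) for each i, and suppose Σ_{i=1}^N (2^{2c*_i} − 1)/h_i = E. Then c* is optimal for the strict-delay distortion-minimization problem: for every c = (c_1,…,c_N) with 0 ≤ c_i ≤ B_max for all i and Σ_{i=1}^N (2^{2c_i} − 1)/h_i ≤ E, one has Σ_{i=1}^N σ_i² 2^{−2c*_i} ≤ Σ_{i=1}^N σ_i² 2^{−2c_i}. Equivalently, the optimal power allocation is p*_i = M_i [min(K_i 2^{2B_max}, 1/λ) − K_i]⁺ with M_i = σ_i/√h_i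 and K_i = 1/(σ_i √h_i) (2D waterfilling). -/
/-- On `[1, M]`, the function `x ↦ t² / x + x` is minimized at the projection of `t`. -/
theorem sq_div_add_le_of_clamp {t M u x : ℝ} (ht : 0 < t) (hM : 1 ≤ M)
    (hu : u = max 1 (min M t)) (hx : 1 ≤ x) (hxM : x ≤ M) :
    t ^ 2 / u + u ≤ t ^ 2 / x + x := by
  have hu1 : 1 ≤ u := hu ▸ le_max_left _ _
  have hx0 : 0 < x := by linarith
  have hu0 : 0 < u := by linarith
  have key : 0 ≤ (x - u) * (x * u - t ^ 2) := by
    rcases le_total t 1 with h | h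
    · have hu' : u = 1 := by rw [hu, min_eq_right (h.trans hM), max_eq_left h]
      subst hu'
      exact mul_nonneg (by linarith) (by nlinarith)
    · rcases le_total t M with h' | h'
      · have hu' : u = t := by rw [hu, min_eq_right h', max_eq_right h]
        subst hu'
        nlinarith [mul_nonneg ht.le (sq_nonneg (x - u))]
      · have hu' : u = M := by rw [hu, min_eq_left h', max_eq_right hM]
        subst hu'
        exact mul_nonneg_of_nonpos_of_nonpos (by linarith) (by nlinarith)
  have hdiff : t ^ 2 / x + x - (t ^ 2 / u + u) = (x - u) * (x * u - t ^ 2) / (x * u) := by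
    field_simp
    ring
  have := div_nonneg key (mul_pos hx0 hu0).le
  linarith

/-- Exponentiating a clamped half-logarithm clamps its argument. -/
theorem two_rpow_two_mul_clamp {t : ℝ} (ht : 0 < t) (B : ℝ) :
    (2 : ℝ) ^ (2 * max 0 (min B ((1 / 2 : ℝ) * Real.logb 2 t)))
      = max 1 (min ((2 : ℝ) ^ (2 * B)) t) := by
  have hmono : Monotone fun y : ℝ => (2 : ℝ) ^ (2 * y) := fun y z hyz =>
    Real.rpow_le_rpow_of_exponent_le (by norm_num) (by linarith)
  have hlog : (2 : ℝ) ^ (2 * ((1 / 2 : ℝ) * Real.logb 2 t)) = t := by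
    rw [← mul_assoc, show (2 : ℝ) * (1 / 2) = 1 by norm_num, one_mul,
      Real.rpow_logb (by norm_num) (by norm_num) ht]
  have h := hmono.map_max (a := 0) (b := min B ((1 / 2 : ℝ) * Real.logb 2 t))
  rw [hmono.map_min] at h
  simpa only [hlog, mul_zero, Real.rpow_zero] using h

/-- The clamped water level minimizes the per-slot Lagrangian of distortion and power. -/
theorem lagrangian_le_of_clamp {s g B lam c : ℝ} (hs : 0 < s) (hg : 0 < g) (hlam : 0 < lam)
    (hc : 0 ≤ c) (hcB : c ≤ B) {d : ℝ}
    (hd : d = max 0 (min B ((1 / 2 : ℝ) * Real.logb 2 (s * Real.sqrt g / lam)))) :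
    s ^ 2 * (2 : ℝ) ^ (-2 * d) + lam ^ 2 * (((2 : ℝ) ^ (2 * d) - 1) / g)
      ≤ s ^ 2 * (2 : ℝ) ^ (-2 * c) + lam ^ 2 * (((2 : ℝ) ^ (2 * c) - 1) / g) := by
  have ht : 0 < s * Real.sqrt g / lam := by positivity
  have hpow : ∀ y : ℝ, 0 ≤ y → 1 ≤ (2 : ℝ) ^ (2 * y) := fun y hy =>
    Real.one_le_rpow (by norm_num) (by linarith)
  have hmin := sq_div_add_le_of_clamp ht (hpow B (hc.trans hcB))
    (hd ▸ two_rpow_two_mul_clamp ht B) (hpow c hc)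
    (Real.rpow_le_rpow_of_exponent_le (by norm_num) (by linarith : 2 * c ≤ 2 * B))
  have hform : ∀ y : ℝ, s ^ 2 * (2 : ℝ) ^ (-2 * y) + lam ^ 2 * (((2 : ℝ) ^ (2 * y) - 1) / g)
      = lam ^ 2 / g * ((s * Real.sqrt g / lam) ^ 2 / (2 : ℝ) ^ (2 * y) + (2 : ℝ) ^ (2 * y))
        - lam ^ 2 / g := by
    intro y
    have hy : (2 : ℝ) ^ (2 * y) ≠ 0 := by positivity
    rw [neg_mul, Real.rpow_neg (by norm_num), div_pow, mul_pow, Real.sq_sqrt hg.le]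
    field_simp
    ring
  rw [hform d, hform c]
  gcongr


/-- 2D waterfilling optimality for the strict-delay (`d = 1`) battery-run problem:
if `c*ᵢ = max(0, min(B_max, (1/2) log₂(σᵢ √hᵢ / λ)))` exhausts the energy budget `E`,
then `c*` minimizes the total distortion `∑ σᵢ² 2^{−2cᵢ}` among all feasible `c`. -/
theorem stmt_12 (N : ℕ) (hN : 1 ≤ N) (σ ch : Fin N → ℝ)
    (hσ : ∀ i, 0 < σ i) (hch : ∀ i, 0 < ch i)
    (Bmax E lam : ℝ) (hB : 0 < Bmax) (hE : 0 ≤ E) (hlam : 0 < lam)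
    (cstar : Fin N → ℝ)
    (hcstar : ∀ i, cstar i = max 0 (min Bmax
      ((1 / 2 : ℝ) * Real.logb 2 (σ i * Real.sqrt (ch i) / lam))))
    (henergy : ∑ i, ((2 : ℝ) ^ (2 * cstar i) - 1) / ch i = E) :
    ∀ c : Fin N → ℝ, (∀ i, 0 ≤ c i) → (∀ i, c i ≤ Bmax) →
      (∑ i, ((2 : ℝ) ^ (2 * c i) - 1) / ch i ≤ E) →
      ∑ i, (σ i) ^ 2 * (2 : ℝ) ^ (-2 * cstar i)
        ≤ ∑ i, (σ i) ^ 2 * (2 : ℝ) ^ (-2 * c i) := by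
  intro c hc0 hcB hcE
  have h := Finset.sum_le_sum fun i (_ : i ∈ Finset.univ) =>
    lagrangian_le_of_clamp (hσ i) (hch i) hlam (hc0 i) (hcB i) (hcstar i)
  rw [Finset.sum_add_distrib, Finset.sum_add_distrib, ← Finset.mul_sum, ← Finset.mul_sum,
    henergy] at h
  have := mul_le_mul_of_nonneg_left hcE (sq_nonneg lam)
  linarith
end

section
/- Let N ≥ 1, let σ_i > 0, h_i > 0 and E_i ≥ 0 for i = 1,…,N, let B_max > 0, and let λ_1,…,λ_N ≥ 0 with Λ_i := Σ_{j=i}^N λ_j > 0 for every i. Define c*_i = max(0, min(B_max, (1/2) log₂(σ_i √h_i / √Λ_i))) and suppose that for every i: Σ_{j=1}^i (2^{2c*_j} − 1)/h_j ≤ Σ_{j=1}^i E_j, and λ_i > 0 implies Σ_{j=1}^i (2^{2c*_j} − 1)/h_j = Σ_{j=1}^i E_j. Then c* is optimal for the energy-harvesting strict-delay problem: for every c = (c_1,…,c_N) with 0 ≤ c_i ≤ B_max for all i and Σ_{j=1}^i (2^{2c_j} − 1)/h_j ≤ Σ_{j=1}^i E_j for all i, one has Σ_{i=1}^N σ_i²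 2^{−2c*_i} ≤ Σ_{i=1}^N σ_i² 2^{−2c_i} (directional 2D waterfilling). -/
/-- A clamped point either is the unclamped one, or lies between it and any point of the
interval. -/
lemma clamp_cases {B u c : ℝ} (hc0 : 0 ≤ c) (hcB : c ≤ B) :
    max 0 (min B u) = u ∨ (u ≤ max 0 (min B u) ∧ max 0 (min B u) ≤ c) ∨
      (c ≤ max 0 (min B u) ∧ max 0 (min B u) ≤ u) := by
  grind

/-- The function `x ↦ a / x + b * x`, with unconstrained minimizer `t = √(a / b)`, is smaller at
`y` than at `x` whenever `y` is `t` or lies between `t` and `x`. -/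
lemma div_add_mul_le_of_between {a b t x y : ℝ} (ha : a = b * t ^ 2) (hb : 0 ≤ b) (ht : 0 < t)
    (hx : 0 < x) (hy : 0 < y) (h : y = t ∨ (t ≤ y ∧ y ≤ x) ∨ (x ≤ y ∧ y ≤ t)) :
    a / y + b * y ≤ a / x + b * x := by
  have key : 0 ≤ (x - y) * (x * y - t ^ 2) := by
    rcases h with rfl | ⟨h1, h2⟩ | ⟨h1, h2⟩
    · nlinarith [mul_nonneg hy.le (sq_nonneg (x - y))]
    · exact mul_nonneg (by linarith) (by nlinarith)
    · exact mul_nonneg_of_nonpos_of_nonpos (by linarith) (by nlinarith)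
  have hdiff : a / x + b * x - (a / y + b * y) = b * ((x - y) * (x * y - t ^ 2)) / (x * y) := by
    rw [ha]
    field_simp
    ring
  have : 0 ≤ b * ((x - y) * (x * y - t ^ 2)) / (x * y) := by positivity
  linarith

/-- The clamped waterfilling rate minimizes the single-slot Lagrangian. -/
lemma slot_lagrangian_le {s h L B c y : ℝ} (hs : 0 < s) (hh : 0 < h) (hL : 0 < L)
    (hc0 : 0 ≤ c) (hcB : c ≤ B)
    (hy : y = max 0 (min B ((1 / 2 : ℝ) * Real.logb 2 (s * Real.sqrt h / Real.sqrt L)))) :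
    s ^ 2 * (2 : ℝ) ^ (-2 * y) + L * (((2 : ℝ) ^ (2 * y) - 1) / h)
      ≤ s ^ 2 * (2 : ℝ) ^ (-2 * c) + L * (((2 : ℝ) ^ (2 * c) - 1) / h) := by
  set t := s * Real.sqrt h / Real.sqrt L with ht_def
  have ht : 0 < t := by positivity
  have htt : (2 : ℝ) ^ (2 * ((1 / 2 : ℝ) * Real.logb 2 t)) = t := by
    rw [← mul_assoc]
    norm_num
    exact Real.rpow_logb (by norm_num) (by norm_num) ht
  have hsq : s ^ 2 = L / h * t ^ 2 := by
    rw [ht_def, div_pow, mul_pow, Real.sq_sqrt hh.le, Real.sq_sqrt hL.le]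
    field_simp
  have mono : ∀ {p q : ℝ}, p ≤ q → (2 : ℝ) ^ (2 * p) ≤ (2 : ℝ) ^ (2 * q) := fun hpq =>
    Real.rpow_le_rpow_of_exponent_le (by norm_num) (by linarith)
  have hbetween : (2 : ℝ) ^ (2 * y) = t ∨ (t ≤ (2 : ℝ) ^ (2 * y) ∧
      (2 : ℝ) ^ (2 * y) ≤ (2 : ℝ) ^ (2 * c)) ∨
      ((2 : ℝ) ^ (2 * c) ≤ (2 : ℝ) ^ (2 * y) ∧ (2 : ℝ) ^ (2 * y) ≤ t) := by
    have hcases := clamp_cases (u := (1 / 2 : ℝ) * Real.logb 2 t) hc0 hcB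
    rw [← hy] at hcases
    rcases hcases with h1 | ⟨h1, h2⟩ | ⟨h1, h2⟩
    · left
      rw [h1, htt]
    · exact Or.inr (Or.inl ⟨htt ▸ mono h1, mono h2⟩)
    · exact Or.inr (Or.inr ⟨mono h1, (mono h2).trans_eq htt⟩)
  have main := div_add_mul_le_of_between hsq (by positivity) ht
    (by positivity) (by positivity) hbetween
  have conv : ∀ z : ℝ, s ^ 2 * (2 : ℝ) ^ (-2 * z) + L * (((2 : ℝ) ^ (2 * z) - 1) / h)
      = s ^ 2 / (2 : ℝ) ^ (2 * z) + L / h * (2 : ℝ) ^ (2 * z) - L / h := by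
    intro z
    rw [neg_mul, Real.rpow_neg (by norm_num)]
    ring
  rw [conv, conv]
  linarith

/-- Summation by parts: weighting by tail sums equals weighting the partial sums. -/
lemma sum_tail_mul {ι R : Type*} [Fintype ι] [Preorder ι] [LocallyFiniteOrderBot ι]
    [LocallyFiniteOrderTop ι] [CommSemiring R] (w p : ι → R) :
    ∑ j, (∑ i ∈ Finset.Ici j, w i) * p j = ∑ i, w i * ∑ j ∈ Finset.Iic i, p j := by
  simp_rw [Finset.sum_mul, Finset.mul_sum]
  exact Finset.sum_comm' (by simp)


/-- Directional 2D waterfilling optimality for the energy-harvesting strict-delay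
(`d = 1`) problem: if `c*ᵢ = max(0, min(B_max, (1/2) log₂(σᵢ √hᵢ / √Λᵢ)))` with
`Λᵢ = ∑_{j ≥ i} λⱼ > 0` is energy-feasible and satisfies complementary slackness with
the energy-causality constraints, then `c*` minimizes the total distortion among all
energy-causal, buffer-feasible rate allocations. -/
theorem stmt_14 (N : ℕ) (hN : 1 ≤ N) (σ ch E : Fin N → ℝ)
    (hσ : ∀ i, 0 < σ i) (hch : ∀ i, 0 < ch i) (hE : ∀ i, 0 ≤ E i)
    (Bmax : ℝ) (hB : 0 < Bmax)
    (lam : Fin N → ℝ) (hlam : ∀ i, 0 ≤ lam i)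
    (hΛ : ∀ i, 0 < ∑ j ∈ Finset.Ici i, lam j)
    (cstar : Fin N → ℝ)
    (hcstar : ∀ i, cstar i = max 0 (min Bmax
      ((1 / 2 : ℝ) * Real.logb 2
        (σ i * Real.sqrt (ch i) / Real.sqrt (∑ j ∈ Finset.Ici i, lam j)))))
    (hfeas : ∀ i, ∑ j ∈ Finset.Iic i, ((2 : ℝ) ^ (2 * cstar j) - 1) / ch j
      ≤ ∑ j ∈ Finset.Iic i, E j)
    (hcs : ∀ i, 0 < lam i →
      ∑ j ∈ Finset.Iic i, ((2 : ℝ) ^ (2 * cstar j) - 1) / ch j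
        = ∑ j ∈ Finset.Iic i, E j) :
    ∀ c : Fin N → ℝ, (∀ i, 0 ≤ c i) → (∀ i, c i ≤ Bmax) →
      (∀ i, ∑ j ∈ Finset.Iic i, ((2 : ℝ) ^ (2 * c j) - 1) / ch j
        ≤ ∑ j ∈ Finset.Iic i, E j) →
      ∑ i, (σ i) ^ 2 * (2 : ℝ) ^ (-2 * cstar i)
        ≤ ∑ i, (σ i) ^ 2 * (2 : ℝ) ^ (-2 * c i) := by
  intro c hc0 hcB hc
  have hslot := Finset.sum_le_sum fun i (_ : i ∈ Finset.univ) =>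
    slot_lagrangian_le (hσ i) (hch i) (hΛ i) (hc0 i) (hcB i) (hcstar i)
  rw [Finset.sum_add_distrib, Finset.sum_add_distrib, sum_tail_mul lam, sum_tail_mul lam] at hslot
  have henergy : ∑ i, lam i * ∑ j ∈ Finset.Iic i, ((2 : ℝ) ^ (2 * c j) - 1) / ch j
      ≤ ∑ i, lam i * ∑ j ∈ Finset.Iic i, ((2 : ℝ) ^ (2 * cstar j) - 1) / ch j := by
    refine Finset.sum_le_sum fun i _ => ?_
    rcases (hlam i).eq_or_lt with h0 | hpos
    · simp [← h0]
    · rw [hcs i hpos]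
      exact mul_le_mul_of_nonneg_left (hc i) (hlam i)
  linarith
end

section
/- For every h > 0 and ε_p > 0, there exists a unique p > 0 satisfying ln(1 + h p) · (1/h + p) = ε_p + p. (Equivalently, equation (ln 2) log₂(1 + h p)(1/h + p) = ε_p + p has a unique solution, which depends only on the channel gain h and the processing cost ε_p.) -/
theorem strictMonoOn_mul_log_sub_self :
    StrictMonoOn (fun x : ℝ => x * Real.log x - x) (Set.Ici 1) := by
  refine strictMonoOn_of_deriv_pos (convex_Ici 1)
    (Real.continuous_mul_log.sub continuous_id).continuousOn fun x hx => ?_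
  rw [interior_Ici, Set.mem_Ioi] at hx
  have hd := (Real.hasDerivAt_mul_log (x := x) (by linarith)).sub (hasDerivAt_id x)
  have hd' : deriv (fun x : ℝ => x * Real.log x - x) x = Real.log x + 1 - 1 := hd.deriv
  rw [hd', add_sub_cancel_right]
  exact Real.log_pos hx

theorem exists_mul_log_sub_self_eq {c : ℝ} (hc : 0 < c) :
    ∃ x : ℝ, 1 < x ∧ x * Real.log x - x = c - 1 := by
  have hcont : ContinuousOn (fun x : ℝ => x * Real.log x - x) (Set.Icc 1 (Real.exp (1 + c))) :=
    (Real.continuous_mul_log.sub continuous_id).continuousOn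
  have hle : (1 : ℝ) ≤ Real.exp (1 + c) := Real.one_le_exp (by linarith)
  obtain ⟨x, hx, hxe⟩ := intermediate_value_Icc hle hcont
    (show c - 1 ∈ Set.Icc _ _ by
      simp only [Set.mem_Icc, Real.log_one, Real.log_exp]
      constructor <;> nlinarith)
  refine ⟨x, lt_of_le_of_ne hx.1 ?_, hxe⟩
  rintro rfl
  simp only [Real.log_one] at hxe
  linarith

/-- For every channel gain `h > 0` and processing cost `ε_p > 0`, the equation
`ln(1 + h p) (1/h + p) = ε_p + p` has a unique positive solution `p`. -/
theorem stmt_15 (h εp : ℝ) (hh : 0 < h) (hεp : 0 < εp) :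
    ∃! p : ℝ, 0 < p ∧ Real.log (1 + h * p) * (1 / h + p) = εp + p := by
  have key : ∀ p : ℝ, Real.log (1 + h * p) * (1 / h + p) = εp + p ↔
      (1 + h * p) * Real.log (1 + h * p) - (1 + h * p) = h * εp - 1 := by
    intro p
    have e : h * (Real.log (1 + h * p) * (1 / h + p)) =
        (1 + h * p) * Real.log (1 + h * p) := by
      field_simp
    rw [← mul_right_inj' hh.ne', e]
    constructor <;> intro H <;> linarith
  obtain ⟨x, hx, hxe⟩ := exists_mul_log_sub_self_eq (mul_pos hh hεp)
  have hxp : 1 + h * ((x - 1) / h) = x := by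
    field_simp
    ring
  refine ⟨(x - 1) / h, ⟨div_pos (by linarith) hh, ?_⟩, ?_⟩
  · rw [key, hxp, hxe]
  · rintro q ⟨hq, hqe⟩
    rw [key] at hqe
    have hq1 : (1 : ℝ) ≤ 1 + h * q := by nlinarith
    have hqx : 1 + h * q = x :=
      strictMonoOn_mul_log_sub_self.injOn hq1 hx.le (hqe.trans hxe.symm)
    rw [eq_div_iff hh.ne']
    linarith
end

section
/- Let r_1, r_2, r_3, c_1, c_2, c_3 and B_max be nonnegative real numbers. Then there exist nonnegative reals R_{1,1}, R_{1,2}, R_{2,2}, R_{2,3}, R_{3,3} satisfying R_{1,1} ≤ c_1; R_{1,2} + R_{2,2} ≤ c_2; R_{2,3} + R_{3,3} ≤ c_3; r_1 ≤ R_{1,1} + R_{1,2}; r_2 ≤ R_{2,2} + R_{2,3}; r_3 ≤ R_{3,3}; R_{1,1} + R_{1,2} ≤ B_max; R_{1,2} + R_{2,2} + R_{2,3} ≤ B_max; R_{2,3} + R_{3,3} ≤ B_max, if and only if the following hold: r_3 ≤ c_3; r_2 + r_3 ≤ c_2 + c_3; r_1 + r_2 + r_3 ≤ c_1 + c_2 +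 c_3; r_1 ≤ c_1 + c_2; r_1 + r_2 ≤ c_1 + B_max; r_1 + r_2 + r_3 ≤ c_1 + c_2 + B_max; r_2 + r_3 ≤ c_2 + B_max; and r_i ≤ B_max for i = 1, 2, 3. -/
/-- Fourier–Motzkin elimination for `N = 3` time slots with delay `d = 2`: the per-slot
scheduling constraints in the rates `R_{i,j}` are feasible if and only if the cumulative
causality, delay and buffer constraints on `(r, c)` hold. -/
theorem stmt_18 (r₁ r₂ r₃ c₁ c₂ c₃ Bmax : ℝ)
    (hr₁ : 0 ≤ r₁) (hr₂ : 0 ≤ r₂) (hr₃ : 0 ≤ r₃)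
    (hc₁ : 0 ≤ c₁) (hc₂ : 0 ≤ c₂) (hc₃ : 0 ≤ c₃) (hB : 0 ≤ Bmax) :
    (∃ R₁₁ R₁₂ R₂₂ R₂₃ R₃₃ : ℝ,
      0 ≤ R₁₁ ∧ 0 ≤ R₁₂ ∧ 0 ≤ R₂₂ ∧ 0 ≤ R₂₃ ∧ 0 ≤ R₃₃ ∧
      R₁₁ ≤ c₁ ∧
      R₁₂ + R₂₂ ≤ c₂ ∧
      R₂₃ + R₃₃ ≤ c₃ ∧
      r₁ ≤ R₁₁ + R₁₂ ∧
      r₂ ≤ R₂₂ + R₂₃ ∧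
      r₃ ≤ R₃₃ ∧
      R₁₁ + R₁₂ ≤ Bmax ∧
      R₁₂ + R₂₂ + R₂₃ ≤ Bmax ∧
      R₂₃ + R₃₃ ≤ Bmax) ↔
    (r₃ ≤ c₃ ∧
      r₂ + r₃ ≤ c₂ + c₃ ∧
      r₁ + r₂ + r₃ ≤ c₁ + c₂ + c₃ ∧
      r₁ ≤ c₁ + c₂ ∧
      r₁ + r₂ ≤ c₁ + Bmax ∧
      r₁ + r₂ + r₃ ≤ c₁ + c₂ + Bmax ∧
      r₂ + r₃ ≤ c₂ + Bmax ∧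
      r₁ ≤ Bmax ∧ r₂ ≤ Bmax ∧ r₃ ≤ Bmax) := by
  constructor
  · rintro ⟨R₁₁, R₁₂, R₂₂, R₂₃, R₃₃, h₁₁, h₁₂, h₂₂, h₂₃, h₃₃, hcap₁, hcap₂, hcap₃,
      hrate₁, hrate₂, hrate₃, hbuf₁, hbuf₂, hbuf₃⟩
    refine ⟨?_, ?_, ?_, ?_, ?_, ?_, ?_, ?_, ?_, ?_⟩ <;> linarith
  · rintro ⟨h₃, h₂₃, h₁₂₃, h₁, hb₁₂, hb₁₂₃, hb₂₃, hb₁, hb₂, hb₃⟩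
    -- Serve each source as early as possible; `a` and `b` are the rates deferred by one slot.
    obtain ⟨a, ha₀, ha₁, ha⟩ : ∃ a, 0 ≤ a ∧ r₁ - c₁ ≤ a ∧ (a = 0 ∨ a = r₁ - c₁) :=
      ⟨max 0 (r₁ - c₁), le_max_left _ _, le_max_right _ _, max_choice _ _⟩
    obtain ⟨b, hb₀, hb₁', hb⟩ : ∃ b, 0 ≤ b ∧ a + r₂ - c₂ ≤ b ∧ (b = 0 ∨ b = a + r₂ - c₂) :=
      ⟨max 0 (a + r₂ - c₂), le_max_left _ _, le_max_right _ _, max_choice _ _⟩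
    refine ⟨r₁ - a, a, r₂ - b, b, r₃, ?_, ?_, ?_, ?_, ?_, ?_, ?_, ?_, ?_, ?_, ?_, ?_, ?_, ?_⟩ <;>
      rcases ha with ha | ha <;> rcases hb with hb | hb <;> linarith
end
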